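/- The space P(V, 𝓗, d), equipped with the seminorms ν_{ω,n}, is a Fréchet space. More precisely: (i) the topology defined by the family of all seminorms ν_{ω,n} (ω ⊆ V₀ bounded open, n ∈ ℕ) coincides with the topology defined by the countable subfamily ν_{B_k, n} (k, n ∈ ℕ, B_k the open ball of radius k centered at 0 in V₀); (ii) this topology is Hausdorff; and (iii) every sequence in P(V, 𝓗, d) that is Cauchy with respect to all the seminorms ν_{ω,n} converges in P(V, 𝓗, d) to an element of P(V, 𝓗, d). -/

import Mathlib

open Filter Topology Bornology

noncomputable section

/-- The complexification `V` of `V₀`, modelled as `EuclideanSpace ℂ (Fin n)`. -/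
abbrev Vc (n : ℕ) := EuclideanSpace ℂ (Fin n)

/-- `V₀`: a finite-dimensional real inner product space, modelled as `EuclideanSpace ℝ (Fin n)`. -/
abbrev Vr (n : ℕ) := EuclideanSpace ℝ (Fin n)

/-- The real part `Re λ ∈ V₀` of `λ ∈ V`. -/
def reP (n : ℕ) (lam : Vc n) : Vr n := WithLp.toLp 2 fun i => (lam i).re

/-- The `ℂ`-bilinear extension `⟨λ, α⟩` of the inner product of `V₀` (`α ∈ V₀`, `λ ∈ V`). -/
def pairC (n : ℕ) (lam : Vc n) (al : Vr n) : ℂ := ∑ i, lam i * (al i : ℂ)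

/-- The tube `ω + iV₀ = {λ ∈ V | Re λ ∈ ω}` over a subset `ω ⊆ V₀`. -/
def Tube (n : ℕ) (ω : Set (Vr n)) : Set (Vc n) := {lam | reP n lam ∈ ω}

/-- The real hyperplane `{λ ∈ V | ⟨λ, α⟩ = s}` determined by `α ∈ V₀ \ {0}` and `s ∈ ℝ`. -/
def RHyp (n : ℕ) (al : Vr n) (s : ℝ) : Set (Vc n) := {lam | pairC n lam al = (s : ℂ)}

/-- The polynomial `π_F(λ) = ∏_{i ∈ F} (⟨λ, α_i⟩ - s_i)^{d i}`. -/
def polyS (n : ℕ) {ι : Type*} (al : ι → Vr n) (s : ι → ℝ) (d : ι → ℕ) (F : Finset ι)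
    (lam : Vc n) : ℂ :=
  ∏ i ∈ F, (pairC n lam (al i) - (s i : ℂ)) ^ (d i)

/-- Membership in `𝓜(V, 𝓗, d)`: `φ` is holomorphic off `⋃𝓗` and for every bounded open
`U ⊆ V` the function `π_U · φ` extends holomorphically to `U`. -/
def MemM (n : ℕ) {ι : Type*} (al : ι → Vr n) (s : ι → ℝ) (d : ι → ℕ) (φ : Vc n → ℂ) :
    Prop :=
  DifferentiableOn ℂ φ (⋃ i, RHyp n (al i) (s i))ᶜ ∧
  ∀ U : Set (Vc n), IsOpen U → IsBounded U →
    ∀ hfin : {i | (RHyp n (al i) (s i) ∩ U).Nonempty}.Finite,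
    ∃ Φ : Vc n → ℂ, DifferentiableOn ℂ Φ U ∧
      ∀ lam ∈ U, lam ∉ ⋃ i, RHyp n (al i) (s i) →
        Φ lam = polyS n al s d hfin.toFinset lam * φ lam

/-- The value `ν_{ω,m}(φ) = sup_{λ ∈ ω + iV₀} (1 + ‖λ‖)^m |(π_{ω+iV₀}·φ)(λ)|` of the
seminorm `ν_{ω,m}`, computed (by density and continuity, equivalently) as the supremum
over the tube minus the hyperplanes, where the raw product `π_{ω+iV₀}·φ` is defined;
here `F` is the finite set of hyperplanes meeting the tube `ω + iV₀`. -/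
def nuVal (n : ℕ) {ι : Type*} (al : ι → Vr n) (s : ι → ℝ) (d : ι → ℕ) (F : Finset ι)
    (ω : Set (Vr n)) (m : ℕ) (φ : Vc n → ℂ) : ℝ :=
  ⨆ lam : ↥(Tube n ω \ ⋃ i, RHyp n (al i) (s i)),
    (1 + ‖(lam : Vc n)‖) ^ m * ‖polyS n al s d F (lam : Vc n) * φ (lam : Vc n)‖

/-- Membership in `P(V, 𝓗, d)`: `φ ∈ 𝓜(V, 𝓗, d)` and all the seminorm values
`ν_{ω,m}(φ)` are finite, i.e. the corresponding suprema are over bounded sets. -/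
def MemP (n : ℕ) {ι : Type*} (al : ι → Vr n) (s : ι → ℝ) (d : ι → ℕ) (φ : Vc n → ℂ) :
    Prop :=
  MemM n al s d φ ∧
  ∀ ω : Set (Vr n), IsOpen ω → IsBounded ω →
    ∀ hfin : {i | (RHyp n (al i) (s i) ∩ Tube n ω).Nonempty}.Finite, ∀ m : ℕ,
    BddAbove (Set.range fun lam : ↥(Tube n ω \ ⋃ i, RHyp n (al i) (s i)) =>
      (1 + ‖(lam : Vc n)‖) ^ m *
        ‖polyS n al s d hfin.toFinset (lam : Vc n) * φ (lam : Vc n)‖)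

/-- The inclusion of `V₀` into its complexification. -/
def realToC (n : ℕ) (v : Vr n) : Vc n := WithLp.toLp 2 fun i => (v i : ℂ)

/-- The union of the hyperplanes of the collection. -/
abbrev hypUnion (n : ℕ) {ι : Type*} (al : ι → Vr n) (s : ι → ℝ) : Set (Vc n) :=
  ⋃ i, RHyp n (al i) (s i)

/-- The points whose real part lies on none of the hyperplanes. -/
def genericSet (n : ℕ) {ι : Type*} (al : ι → Vr n) (s : ι → ℝ) : Set (Vc n) :=
  {lam | ∀ i, (pairC n lam (al i)).re ≠ s i}

section Pairing

variable {n : ℕ}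

lemma norm_realToC (v : Vr n) : ‖realToC n v‖ = ‖v‖ := by
  simp [realToC, EuclideanSpace.norm_eq]

lemma pairC_eq_inner (lam : Vc n) (al : Vr n) : pairC n lam al = inner ℂ (realToC n al) lam := by
  simp [pairC, realToC, PiLp.inner_apply]

lemma re_pairC (lam : Vc n) (al : Vr n) : (pairC n lam al).re = inner ℝ al (reP n lam) := by
  simp [pairC, reP, PiLp.inner_apply]

lemma pairC_add_smul_realToC (lam : Vc n) (z : ℂ) (v al : Vr n) :
    pairC n (lam + z • realToC n v) al = pairC n lam al + z * (inner ℝ al v : ℝ) := by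
  simp only [pairC, realToC, PiLp.inner_apply, PiLp.add_apply, PiLp.smul_apply, smul_eq_mul,
    add_mul, Finset.sum_add_distrib, Complex.ofReal_sum, Finset.mul_sum]
  congr 1
  refine Finset.sum_congr rfl fun i _ => ?_
  simp
  ring

lemma reP_add_smul_realToC (lam : Vc n) (z : ℂ) (v : Vr n) :
    reP n (lam + z • realToC n v) = reP n lam + z.re • v := by
  ext i
  simp [reP, realToC]

lemma norm_reP_le (lam : Vc n) : ‖reP n lam‖ ≤ ‖lam‖ := by
  rw [EuclideanSpace.norm_eq, EuclideanSpace.norm_eq]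
  gcongr with i
  simpa [reP] using Complex.abs_re_le_norm (lam i)

lemma continuous_reP : Continuous (reP n) := by
  unfold reP
  fun_prop

lemma differentiable_pairC (al : Vr n) : Differentiable ℂ fun lam => pairC n lam al := by
  unfold pairC
  fun_prop

lemma norm_pairC_le (lam : Vc n) (al : Vr n) : ‖pairC n lam al‖ ≤ ‖lam‖ * ‖al‖ := by
  rw [pairC_eq_inner, mul_comm, ← norm_realToC al]
  exact norm_inner_le_norm _ _

lemma isOpen_tube {ω : Set (Vr n)} (hω : IsOpen ω) : IsOpen (Tube n ω) :=
  hω.preimage continuous_reP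

variable {ι : Type*} (al : ι → Vr n) (s : ι → ℝ) (d : ι → ℕ)

lemma norm_polyS_le (F : Finset ι) (lam : Vc n) :
    ‖polyS n al s d F lam‖ ≤
      (∏ i ∈ F, (‖al i‖ + |s i|) ^ d i) * (1 + ‖lam‖) ^ (∑ i ∈ F, d i) := by
  rw [polyS, norm_prod, ← Finset.prod_pow_eq_pow_sum, ← Finset.prod_mul_distrib]
  refine Finset.prod_le_prod (fun i _ => norm_nonneg _) fun i _ => ?_
  rw [norm_pow, ← mul_pow]
  gcongr
  calc ‖pairC n lam (al i) - (s i : ℂ)‖ ≤ ‖lam‖ * ‖al i‖ + |s i| := by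
        refine (norm_sub_le _ _).trans ?_
        gcongr
        · exact norm_pairC_le _ _
        · simp
    _ ≤ _ := by nlinarith [norm_nonneg lam, norm_nonneg (al i), abs_nonneg (s i)]

variable {al s d}

lemma polyS_ne_zero {F : Finset ι} {lam : Vc n} (h : lam ∉ hypUnion n al s) :
    polyS n al s d F lam ≠ 0 := by
  refine Finset.prod_ne_zero_iff.2 fun i _ => pow_ne_zero _ (sub_ne_zero.2 fun h' => h ?_)
  exact Set.mem_iUnion.2 ⟨i, h'⟩

lemma genericSet_subset_compl : genericSet n al s ⊆ (hypUnion n al s)ᶜ := by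
  intro lam h h'
  obtain ⟨i, hi⟩ := Set.mem_iUnion.1 h'
  exact h i (by rw [show pairC n lam (al i) = s i from hi, Complex.ofReal_re])

lemma isClosed_RHyp (a : Vr n) (t : ℝ) : IsClosed (RHyp n a t) :=
  isClosed_eq (differentiable_pairC a).continuous continuous_const

lemma isClosed_hypUnion
    (hloc : ∀ lam : Vc n, ∃ U ∈ 𝓝 lam, {i | (RHyp n (al i) (s i) ∩ U).Nonempty}.Finite) :
    IsClosed (hypUnion n al s) :=
  LocallyFinite.isClosed_iUnion hloc fun _ => isClosed_RHyp _ _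

/-- A vector on which finitely many nonzero functionals do not vanish. -/
lemma exists_norm_le_one_inner_ne_zero (hal : ∀ i, al i ≠ 0) (F : Finset ι) :
    ∃ v : Vr n, ‖v‖ ≤ 1 ∧ ∀ i ∈ F, inner ℝ (al i) v ≠ 0 := by
  obtain ⟨v, hv⟩ := Module.Dual.exists_forall_ne_zero_of_forall_exists
    (fun i : F => ((innerSL ℝ (al i)).toLinearMap : Module.Dual ℝ (Vr n)))
    (fun i => ⟨al i, by simpa using hal i⟩)
  have hpos : 0 < 1 + ‖v‖ := by positivity
  refine ⟨(1 + ‖v‖)⁻¹ • v, ?_, fun i hi => ?_⟩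
  · rw [norm_smul, norm_inv, Real.norm_of_nonneg hpos.le, inv_mul_le_iff₀ hpos]
    linarith
  · rw [inner_smul_right]
    exact mul_ne_zero (inv_ne_zero hpos.ne') (hv ⟨i, hi⟩)

/-- A tube over a bounded open set that meets a hyperplane over a point of `V₀` meets it. -/
lemma mem_of_re_pairC_eq {ω : Set (Vr n)} {lam : Vc n} (hlam : lam ∈ Tube n ω) {i : ι}
    (hi : (pairC n lam (al i)).re = s i) : (RHyp n (al i) (s i) ∩ Tube n ω).Nonempty := by
  refine ⟨realToC n (reP n lam), ?_, ?_⟩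
  · rw [re_pairC] at hi
    have := pairC_add_smul_realToC 0 1 (reP n lam) (al i)
    rw [hi] at this
    simpa [pairC, RHyp] using this
  · have := reP_add_smul_realToC 0 1 (reP n lam)
    have h0 : reP n (0 : Vc n) = 0 := by ext i; simp [reP]
    simp only [h0, zero_add, one_smul, Complex.one_re] at this
    simpa [Tube, this] using hlam

lemma mem_closure_inter_genericSet (hal : ∀ i, al i ≠ 0)
    (hfin : ∀ ω : Set (Vr n), IsBounded ω →
      {i | (RHyp n (al i) (s i) ∩ Tube n ω).Nonempty}.Finite)
    {U : Set (Vc n)} (hU : IsOpen U) {lam : Vc n} (hlam : lam ∈ U) :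
    lam ∈ closure (U ∩ genericSet n al s) := by
  set ω := Metric.ball (reP n lam) 1
  have hω := hfin ω Metric.isBounded_ball
  obtain ⟨v, -, hv⟩ := exists_norm_le_one_inner_ne_zero hal hω.toFinset
  set γ : ℝ → Vc n := fun t => lam + (t : ℂ) • realToC n v
  have hγ : Continuous γ := by fun_prop
  have hγ0 : Tendsto γ (𝓝[≠] 0) (𝓝 lam) := by
    have : Tendsto γ (𝓝 0) (𝓝 (γ 0)) := hγ.tendsto 0
    simp only [γ, Complex.ofReal_zero, zero_smul, add_zero] at this
    exact this.mono_left nhdsWithin_le_nhds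
  have hroot : ∀ i ∈ hω.toFinset, ∀ᶠ t : ℝ in 𝓝[≠] 0, (pairC n (γ t) (al i)).re ≠ s i := by
    intro i hi
    set b : ℝ := inner ℝ (al i) v
    have hb : b ≠ 0 := hv i hi
    have hev : ∀ᶠ t : ℝ in 𝓝[≠] 0, t ≠ (s i - (pairC n lam (al i)).re) / b := by
      by_cases h : (s i - (pairC n lam (al i)).re) / b = 0
      · rw [h]; exact self_mem_nhdsWithin
      · exact nhdsWithin_le_nhds (isOpen_ne.mem_nhds (Ne.symm h))
    filter_upwards [hev] with t ht h
    apply ht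
    rw [pairC_add_smul_realToC, ← Complex.ofReal_mul, Complex.add_re, Complex.ofReal_re] at h
    rw [eq_div_iff hb]
    linarith
  refine mem_closure_of_tendsto hγ0 ?_
  have h1 : ∀ᶠ t in 𝓝[≠] (0 : ℝ), γ t ∈ U := hγ0.eventually (hU.mem_nhds hlam)
  have h2 : ∀ᶠ t in 𝓝[≠] (0 : ℝ), γ t ∈ Tube n ω :=
    hγ0.eventually ((isOpen_tube Metric.isOpen_ball).mem_nhds
      (show reP n lam ∈ ω from Metric.mem_ball_self one_pos))
  filter_upwards [h1, h2, (Filter.eventually_all_finset hω.toFinset).2 hroot] with t ht1 ht2 ht3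
  exact ⟨ht1, fun i hi => ht3 i (hω.mem_toFinset.2 (mem_of_re_pairC_eq ht2 hi)) hi⟩

/-- A bound at the generic points of an open set propagates by continuity. -/
lemma le_of_forall_genericSet_le (hal : ∀ i, al i ≠ 0)
    (hfin : ∀ ω : Set (Vr n), IsBounded ω →
      {i | (RHyp n (al i) (s i) ∩ Tube n ω).Nonempty}.Finite)
    {U : Set (Vc n)} (hU : IsOpen U) {G : Vc n → ℝ} (hG : ContinuousOn G U) {C : ℝ}
    (h : ∀ lam ∈ U ∩ genericSet n al s, G lam ≤ C) {lam : Vc n} (hlam : lam ∈ U) :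
    G lam ≤ C := by
  by_contra! hC
  have hev := (hG.continuousAt (hU.mem_nhds hlam)).eventually (lt_mem_nhds hC)
  obtain ⟨mu, hmu, hlt⟩ := ((mem_closure_iff_frequently.1
    (mem_closure_inter_genericSet hal hfin hU hlam)).and_eventually hev).exists
  exact absurd (h mu hmu) (not_le.2 hlt)

/-- Every point of the tube over `ω` that is generic lies in the tube over an open part of `ω`
which meets no hyperplane. -/
lemma exists_isOpen_tube_inter_genericSet
    (hfin : ∀ ω : Set (Vr n), IsBounded ω →
      {i | (RHyp n (al i) (s i) ∩ Tube n ω).Nonempty}.Finite)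
    {ω : Set (Vr n)} (hω₁ : IsOpen ω) (hω₂ : IsBounded ω) :
    ∃ (ω' : Set (Vr n)) (_ : IsOpen ω') (hω' : IsBounded ω'),
      Tube n ω ∩ genericSet n al s ⊆ Tube n ω' \ hypUnion n al s ∧
        (hfin ω' hω').toFinset = ∅ := by
  set F := (hfin ω hω₂).toFinset
  set ω' : Set (Vr n) := ω ∩ ⋂ i ∈ F, {x | inner ℝ (al i) x ≠ s i}
  have ho : IsOpen ω' := hω₁.inter <| isOpen_biInter_finset fun i _ =>
    isOpen_ne_fun (by fun_prop) continuous_const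
  have hb : IsBounded ω' := hω₂.subset Set.inter_subset_left
  refine ⟨ω', ho, hb, ?_, ?_⟩
  · rintro lam ⟨h1, h2⟩
    refine ⟨⟨h1, Set.mem_iInter₂.2 fun i _ => ?_⟩, genericSet_subset_compl h2⟩
    have := h2 i
    rwa [re_pairC] at this
  · refine Finset.eq_empty_of_forall_notMem fun i hi => ?_
    obtain ⟨mu, hmu, hmu'⟩ := (hfin ω' hb).mem_toFinset.1 hi
    have hiF : i ∈ F := (hfin ω hω₂).mem_toFinset.2 ⟨mu, hmu, hmu'.1⟩
    have := Set.mem_iInter₂.1 hmu'.2 i hiF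
    apply this
    rw [← re_pairC, show pairC n mu (al i) = s i from hmu, Complex.ofReal_re]

/-- Functions in `P(V, 𝓗, d)` are rapidly decreasing on tubes without any clearing of poles. -/
lemma MemP.exists_bound (hal : ∀ i, al i ≠ 0)
    (hloc : ∀ lam : Vc n, ∃ U ∈ 𝓝 lam, {i | (RHyp n (al i) (s i) ∩ U).Nonempty}.Finite)
    (hfin : ∀ ω : Set (Vr n), IsBounded ω →
      {i | (RHyp n (al i) (s i) ∩ Tube n ω).Nonempty}.Finite)
    {φ : Vc n → ℂ} (hφ : MemP n al s d φ) {ω : Set (Vr n)} (hω₁ : IsOpen ω)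
    (hω₂ : IsBounded ω) :
    ∃ C, ∀ lam ∈ Tube n ω \ hypUnion n al s, ‖φ lam‖ ≤ C := by
  obtain ⟨ω', ho, hb, hsub, hemp⟩ := exists_isOpen_tube_inter_genericSet hfin hω₁ hω₂
  obtain ⟨C, hC⟩ := hφ.2 ω' ho hb (hfin ω' hb) 0
  refine ⟨C, fun lam hlam => ?_⟩
  refine le_of_forall_genericSet_le (G := fun lam => ‖φ lam‖) hal hfin
    ((isOpen_tube hω₁).sdiff (isClosed_hypUnion hloc))
    (hφ.1.1.continuousOn.norm.mono fun x hx => hx.2) ?_ hlam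
  rintro mu ⟨⟨h1, -⟩, h2⟩
  have := hC ⟨⟨mu, hsub ⟨h1, h2⟩⟩, rfl⟩
  simpa [hemp, polyS] using this

end Pairing

section OneVariable

/-- A bounded holomorphic function on an open set minus a finite set extends holomorphically. -/
lemma exists_differentiableOn_of_bounded_off_finite {f : ℂ → ℂ} {U S : Set ℂ} (hU : IsOpen U)
    (hS : S.Finite) (hf : DifferentiableOn ℂ f (U \ S)) {C : ℝ}
    (hC : ∀ z ∈ U \ S, ‖f z‖ ≤ C) :
    ∃ g : ℂ → ℂ, DifferentiableOn ℂ g U ∧ ∀ z ∈ U \ S, g z = f z := by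
  have hUS : IsOpen (U \ S) := hU.sdiff hS.isClosed
  have heq : ∀ z ∈ U \ S, limUnder (𝓝[≠] z) f = f z := fun z hz =>
    Tendsto.limUnder_eq
      ((hf.continuousOn.continuousAt (hUS.mem_nhds hz)).tendsto.mono_left nhdsWithin_le_nhds)
  refine ⟨fun z => limUnder (𝓝[≠] z) f, fun c hc => ?_, heq⟩
  set s : Set ℂ := U \ (S \ {c})
  have hs : s ∈ 𝓝 c := (hU.sdiff (hS.subset Set.sdiff_subset).isClosed).mem_nhds ⟨hc, by simp⟩
  have hsub : s \ {c} ⊆ U \ S := fun z hz => ⟨hz.1.1, fun h => hz.1.2 ⟨h, hz.2⟩⟩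
  have hd := Complex.differentiableOn_update_limUnder_of_bddAbove hs (hf.mono hsub)
    ⟨C, by rintro _ ⟨z, hz, rfl⟩; exact hC z (hsub hz)⟩
  refine ((hd.differentiableAt hs).congr_of_eventuallyEq ?_).differentiableWithinAt
  filter_upwards [hs] with z hz
  by_cases h : z = c
  · subst h; simp
  · rw [Function.update_of_ne h]
    exact heq z (hsub ⟨hz, h⟩)

/-- The value at the centre of a disc of a bounded holomorphic function is controlled by its
product with finitely many linear factors. -/
lemma prod_norm_pow_mul_norm_le {ι : Type*} (F : Finset ι) (a b : ι → ℂ) (d : ι → ℕ) {f : ℂ → ℂ}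
    {S : Set ℂ} (hS : S.Finite) (hf : DifferentiableOn ℂ f (Metric.ball 0 2 \ S)) {C M : ℝ}
    (hC : ∀ z ∈ Metric.ball 0 2 \ S, ‖f z‖ ≤ C)
    (hM : ∀ z ∈ Metric.ball 0 2 \ S, ‖(∏ i ∈ F, (a i + z * b i) ^ d i) * f z‖ ≤ M)
    (h0 : (0 : ℂ) ∉ S) :
    (∏ i ∈ F, ‖b i‖ ^ d i) * ‖f 0‖ ≤ M := by
  obtain ⟨g, hg, hgf⟩ :=
    exists_differentiableOn_of_bounded_off_finite Metric.isOpen_ball hS hf hC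
  have hmem : (0 : ℂ) ∈ Metric.ball (0 : ℂ) 2 := Metric.mem_ball_self two_pos
  have hbound : ∀ z ∈ Metric.ball (0 : ℂ) 2, ‖(∏ i ∈ F, (a i + z * b i) ^ d i) * g z‖ ≤ M := by
    intro z hz
    have hcont : ContinuousAt (fun z => ‖(∏ i ∈ F, (a i + z * b i) ^ d i) * g z‖) z := by
      have := hg.continuousOn.continuousAt (Metric.isOpen_ball.mem_nhds hz)
      fun_prop
    refine le_of_tendsto (hcont.tendsto.mono_left (nhdsWithin_le_nhds (s := {z}ᶜ))) ?_
    have hs : Metric.ball (0 : ℂ) 2 \ (S \ {z}) ∈ 𝓝 z :=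
      (Metric.isOpen_ball.sdiff (hS.subset Set.sdiff_subset).isClosed).mem_nhds ⟨hz, by simp⟩
    filter_upwards [self_mem_nhdsWithin, nhdsWithin_le_nhds hs] with w hw hw'
    have : w ∈ Metric.ball (0 : ℂ) 2 \ S := ⟨hw'.1, fun h => hw'.2 ⟨h, hw⟩⟩
    rw [hgf w this]
    exact hM w this
  set h : ℂ → ℂ := fun z =>
    (∏ i ∈ F, (z * (starRingEnd ℂ) (a i) + (starRingEnd ℂ) (b i)) ^ d i) * g z
  have hh : DifferentiableOn ℂ h (Metric.ball 0 2) := by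
    refine DifferentiableOn.fun_mul (Differentiable.differentiableOn ?_) hg
    exact Differentiable.fun_finsetProd fun i _ => by fun_prop
  have hcl : DiffContOnCl ℂ h (Metric.ball 0 1) :=
    (hh.mono (by
      rw [closure_ball _ one_ne_zero]
      exact Metric.closedBall_subset_ball one_lt_two)).diffContOnCl
  have := Complex.norm_le_of_forall_mem_frontier_norm_le Metric.isBounded_ball hcl (C := M)
    (fun z hz => ?_) (subset_closure (Metric.mem_ball_self one_pos))
  · simpa [h, hgf 0 ⟨hmem, h0⟩] using this
  · rw [frontier_ball _ one_ne_zero, mem_sphere_zero_iff_norm] at hz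
    refine le_of_eq_of_le ?_ (hbound z (by simp [hz]))
    simp only [h, norm_mul, norm_prod, norm_pow]
    congr 1
    refine Finset.prod_congr rfl fun i _ => ?_
    congr 1
    have hzz : z * (starRingEnd ℂ) z = 1 := by rw [Complex.mul_conj']; simp [hz]
    have : z * (starRingEnd ℂ) (a i) + (starRingEnd ℂ) (b i) =
        z * (starRingEnd ℂ) (a i + z * b i) := by
      rw [map_add, map_mul]
      linear_combination -(starRingEnd ℂ) (b i) * hzz
    rw [this, norm_mul, hz, one_mul, RCLike.norm_conj]

end OneVariable

section Limits

variable {E : Type*} [NormedAddCommGroup E] [NormedSpace ℂ E]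

/-- A uniform limit of holomorphic functions on an open set is holomorphic. -/
lemma differentiableOn_of_uniformCauchySeqOn {f : ℕ → E → ℂ} {g : E → ℂ} {U : Set E}
    (hU : IsOpen U) (hf : ∀ j, DifferentiableOn ℂ (f j) U)
    (hc : ∀ ε > 0, ∃ N, ∀ j ≥ N, ∀ k ≥ N, ∀ x ∈ U, ‖f j x - f k x‖ ≤ ε)
    (hg : ∀ x ∈ U, Tendsto (fun j => f j x) atTop (𝓝 (g x))) : DifferentiableOn ℂ g U := by
  intro x hx
  obtain ⟨r, hr, hrU⟩ := Metric.isOpen_iff.1 hU x hx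
  have hr2 : 0 < r / 2 := half_pos hr
  have hsub : ∀ y ∈ Metric.ball x (r / 2), Metric.ball y (r / 2) ⊆ U := fun y hy =>
    (Metric.ball_subset_ball' (by rw [Metric.mem_ball] at hy; linarith)).trans hrU
  have hd : ∀ j, ∀ y ∈ U, DifferentiableAt ℂ (f j) y := fun j y hy =>
    (hf j).differentiableAt (hU.mem_nhds hy)
  have hcauchy : UniformCauchySeqOn (fun j => fderiv ℂ (f j)) atTop (Metric.ball x (r / 2)) := by
    rw [Metric.uniformCauchySeqOn_iff]
    intro ε hε
    obtain ⟨N, hN⟩ := hc (ε * r / 12) (by positivity)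
    refine ⟨N, fun j hj k hk y hy => ?_⟩
    have hyU : y ∈ U := hsub y hy (Metric.mem_ball_self hr2)
    have := Complex.norm_fderiv_le_div_of_mapsTo_ball (f := fun y => f j y - f k y) (c := y)
      (R₁ := r / 2) (R₂ := ε * r / 4) (((hf j).sub (hf k)).mono (hsub y hy)) (fun z hz => ?_) hr2
    · rw [dist_eq_norm, ← fderiv_fun_sub (hd j y hyU) (hd k y hyU)]
      refine this.trans_lt ?_
      rw [div_lt_iff₀ hr2]
      nlinarith [mul_pos hε hr]
    · rw [Metric.mem_closedBall, dist_eq_norm]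
      have h1 := hN j hj k hk z (hsub y hy hz)
      have h2 := hN j hj k hk y hyU
      refine (norm_sub_le _ _).trans ?_
      nlinarith [mul_pos hε hr]
  have hlim : ∀ y ∈ Metric.ball x (r / 2),
      Tendsto (fun j => fderiv ℂ (f j) y) atTop (𝓝 (limUnder atTop fun j => fderiv ℂ (f j) y)) :=
    fun y hy => (hcauchy.cauchySeq hy).tendsto_limUnder
  exact (hasFDerivAt_of_tendstoUniformlyOn Metric.isOpen_ball
    (hcauchy.tendstoUniformlyOn_of_tendsto hlim)
    (fun j y hy => (hd j y (hsub y hy (Metric.mem_ball_self hr2))).hasFDerivAt)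
    (fun y hy => hg y (hsub y hy (Metric.mem_ball_self hr2)))
    (Metric.mem_ball_self hr2)).differentiableAt.differentiableWithinAt

end Limits

section Domination

variable {n : ℕ} {ι : Type*} {al : ι → Vr n} {s : ι → ℝ} {d : ι → ℕ}

/-- Each term of the supremum defining a seminorm is bounded by the seminorm. -/
lemma MemP.le_nuVal {φ : Vc n → ℂ} (hφ : MemP n al s d φ) {ω : Set (Vr n)} (hω₁ : IsOpen ω)
    (hω₂ : IsBounded ω) (hfin : {i | (RHyp n (al i) (s i) ∩ Tube n ω).Nonempty}.Finite) (m : ℕ)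
    {lam : Vc n} (hlam : lam ∈ Tube n ω \ hypUnion n al s) :
    (1 + ‖lam‖) ^ m * ‖polyS n al s d hfin.toFinset lam * φ lam‖ ≤
      nuVal n al s d hfin.toFinset ω m φ :=
  le_ciSup (hφ.2 ω hω₁ hω₂ hfin m) ⟨lam, hlam⟩

lemma nuVal_nonneg (F : Finset ι) (ω : Set (Vr n)) (m : ℕ) (φ : Vc n → ℂ) :
    0 ≤ nuVal n al s d F ω m φ :=
  Real.iSup_nonneg fun _ => by positivity

/-- The values of a function in `P(V, 𝓗, d)` on a tube are controlled by its product with the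
polynomial `π` on a larger tube. -/
lemma MemP.norm_mul_le_nuVal (hal : ∀ i, al i ≠ 0)
    (hloc : ∀ lam : Vc n, ∃ U ∈ 𝓝 lam, {i | (RHyp n (al i) (s i) ∩ U).Nonempty}.Finite)
    (hfin : ∀ ω : Set (Vr n), IsBounded ω →
      {i | (RHyp n (al i) (s i) ∩ Tube n ω).Nonempty}.Finite)
    {φ : Vc n → ℂ} (hφ : MemP n al s d φ) {k : ℝ} {v : Vr n} (hv : ‖v‖ ≤ 1)
    (hv' : ∀ i ∈ (hfin (Metric.ball 0 k) Metric.isBounded_ball).toFinset,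
      (inner ℝ (al i) v : ℝ) ≠ 0) (m : ℕ) {lam : Vc n} (hlam : ‖reP n lam‖ + 2 ≤ k)
    (hlam' : lam ∉ hypUnion n al s) :
    (∏ i ∈ (hfin (Metric.ball 0 k) Metric.isBounded_ball).toFinset,
        |(inner ℝ (al i) v : ℝ)| ^ d i) * ((1 + ‖lam‖) ^ m * ‖φ lam‖) ≤
      3 ^ m * nuVal n al s d (hfin (Metric.ball 0 k) Metric.isBounded_ball).toFinset
        (Metric.ball 0 k) m φ := by
  set hB := hfin (Metric.ball 0 k) Metric.isBounded_ball
  set F := hB.toFinset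
  set S := nuVal n al s d F (Metric.ball 0 k) m φ
  set a : ι → ℂ := fun i => pairC n lam (al i) - (s i : ℂ)
  set b : ι → ℂ := fun i => ((inner ℝ (al i) v : ℝ) : ℂ)
  set γ : ℂ → Vc n := fun z => lam + z • realToC n v
  have hγ : Differentiable ℂ γ := by fun_prop
  set T : Set ℂ := (fun i => -a i / b i) '' (F : Set ι)
  have hpair : ∀ z i, pairC n (γ z) (al i) - (s i : ℂ) = a i + z * b i := fun z i => by
    simp only [γ, a, b, pairC_add_smul_realToC]
    ring
  have hball : ∀ z ∈ Metric.ball (0 : ℂ) 2, γ z ∈ Tube n (Metric.ball 0 k) := by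
    intro z hz
    rw [mem_ball_zero_iff] at hz
    simp only [Tube, Set.mem_ofPred_eq, γ, reP_add_smul_realToC, mem_ball_zero_iff]
    have h1 := norm_add_le (reP n lam) (z.re • v)
    have h2 : ‖z.re • v‖ ≤ ‖z‖ * 1 := by
      rw [norm_smul]
      exact mul_le_mul (Complex.abs_re_le_norm z) hv (norm_nonneg _) (norm_nonneg _)
    linarith
  have hγmem : ∀ z ∈ Metric.ball (0 : ℂ) 2 \ T,
      γ z ∈ Tube n (Metric.ball 0 k) \ hypUnion n al s := by
    rintro z ⟨hz, hzT⟩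
    refine ⟨hball z hz, fun h => ?_⟩
    obtain ⟨i, hi⟩ := Set.mem_iUnion.1 h
    have hiF : i ∈ F := hB.mem_toFinset.2 ⟨γ z, hi, hball z hz⟩
    have hbi : b i ≠ 0 := Complex.ofReal_ne_zero.2 (hv' i hiF)
    refine hzT ⟨i, hiF, ?_⟩
    have h0 := hpair z i
    rw [show pairC n (γ z) (al i) = s i from hi, sub_self] at h0
    beta_reduce
    rw [div_eq_iff hbi]
    linear_combination h0
  obtain ⟨C, hC⟩ := hφ.exists_bound hal hloc hfin Metric.isOpen_ball
    (Metric.isBounded_ball (x := (0 : Vr n)) (r := k))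
  have hclosed := isClosed_hypUnion hloc
  have hdiff : DifferentiableOn ℂ (fun z => φ (γ z)) (Metric.ball 0 2 \ T) := fun z hz =>
    (((hφ.1.1.differentiableAt (hclosed.isOpen_compl.mem_nhds (hγmem z hz).2)).comp z
      (hγ z))).differentiableWithinAt
  have key := prod_norm_pow_mul_norm_le F a b d (F.finite_toSet.image _) hdiff
    (fun z hz => hC _ (hγmem z hz)) (M := 3 ^ m * S / (1 + ‖lam‖) ^ m) ?_ ?_
  · simp only [γ, zero_smul, add_zero, b, Complex.norm_real, Real.norm_eq_abs] at key
    rw [le_div_iff₀ (by positivity)] at key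
    linarith
  · intro z hz
    have h1 := hφ.le_nuVal Metric.isOpen_ball Metric.isBounded_ball hB m (hγmem z hz)
    have hpoly : polyS n al s d F (γ z) = ∏ i ∈ F, (a i + z * b i) ^ d i := by
      simp only [polyS, hpair]
    rw [hpoly] at h1
    have hnorm : 1 + ‖lam‖ ≤ 3 * (1 + ‖γ z‖) := by
      have h3 : ‖z • realToC n v‖ ≤ 2 * 1 := by
        rw [norm_smul, norm_realToC]
        exact mul_le_mul (mem_ball_zero_iff.1 hz.1).le hv (norm_nonneg _) two_pos.le
      have h4 : ‖lam‖ ≤ ‖γ z‖ + ‖z • realToC n v‖ := by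
        have := norm_sub_le (γ z) (z • realToC n v)
        simpa [γ] using this
      linarith [norm_nonneg (γ z)]
    rw [le_div_iff₀ (by positivity)]
    set X := ‖(∏ i ∈ F, (a i + z * b i) ^ d i) * φ (γ z)‖
    calc X * (1 + ‖lam‖) ^ m ≤ X * (3 * (1 + ‖γ z‖)) ^ m := by gcongr
      _ = 3 ^ m * ((1 + ‖γ z‖) ^ m * X) := by rw [mul_pow]; ring
      _ ≤ 3 ^ m * S := by gcongr
  · rintro ⟨i, hi, h0⟩
    have hbi : b i ≠ 0 := Complex.ofReal_ne_zero.2 (hv' i hi)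
    have ha : a i = 0 := by simpa [hbi] using h0
    exact hlam' (Set.mem_iUnion.2 ⟨i, sub_eq_zero.1 ha⟩)

/-- The seminorms over balls dominate all the seminorms. -/
lemma exists_nuVal_le_mul_nuVal_ball (hal : ∀ i, al i ≠ 0)
    (hloc : ∀ lam : Vc n, ∃ U ∈ 𝓝 lam, {i | (RHyp n (al i) (s i) ∩ U).Nonempty}.Finite)
    (hfin : ∀ ω : Set (Vr n), IsBounded ω →
      {i | (RHyp n (al i) (s i) ∩ Tube n ω).Nonempty}.Finite)
    {ω : Set (Vr n)} (hω : IsBounded ω) (F : Finset ι) (m : ℕ) :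
    ∃ (k : ℕ) (m' : ℕ) (C : ℝ), 0 ≤ C ∧ ∀ φ : Vc n → ℂ, MemP n al s d φ →
      nuVal n al s d F ω m φ ≤
        C * nuVal n al s d (hfin (Metric.ball (0 : Vr n) k) Metric.isBounded_ball).toFinset
          (Metric.ball (0 : Vr n) k) m' φ := by
  obtain ⟨R, hR⟩ := hω.exists_norm_le
  obtain ⟨k, hk⟩ := exists_nat_ge (R + 2)
  obtain ⟨v, hv, hv'⟩ := exists_norm_le_one_inner_ne_zero hal
    (hfin (Metric.ball 0 k) Metric.isBounded_ball).toFinset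
  set c := ∏ i ∈ (hfin (Metric.ball 0 k) Metric.isBounded_ball).toFinset,
    |(inner ℝ (al i) v : ℝ)| ^ d i
  have hc : 0 < c := Finset.prod_pos fun i hi => pow_pos (abs_pos.2 (hv' i hi)) _
  set A := ∏ i ∈ F, (‖al i‖ + |s i|) ^ d i
  have hA : 0 ≤ A := Finset.prod_nonneg fun i _ => by positivity
  set m' := m + ∑ i ∈ F, d i
  refine ⟨k, m', A * 3 ^ m' / c, by positivity, fun φ hφ => ?_⟩
  have hS := nuVal_nonneg (al := al) (s := s) (d := d)
    (hfin (Metric.ball 0 k) Metric.isBounded_ball).toFinset (Metric.ball (0 : Vr n) k) m' φ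
  refine Real.iSup_le ?_ (by positivity)
  rintro ⟨lam, hlam, hlam'⟩
  have key := hφ.norm_mul_le_nuVal hal hloc hfin hv hv' m' (lam := lam)
    (by linarith [hR _ hlam]) hlam'
  set S := nuVal n al s d (hfin (Metric.ball 0 k) Metric.isBounded_ball).toFinset
    (Metric.ball (0 : Vr n) k) m' φ
  rw [div_mul_eq_mul_div, le_div_iff₀ hc]
  calc (1 + ‖lam‖) ^ m * ‖polyS n al s d F lam * φ lam‖ * c
      ≤ (1 + ‖lam‖) ^ m * (A * (1 + ‖lam‖) ^ (∑ i ∈ F, d i) * ‖φ lam‖) * c := by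
        rw [norm_mul]
        gcongr
        exact norm_polyS_le al s d F lam
    _ = A * (c * ((1 + ‖lam‖) ^ m' * ‖φ lam‖)) := by
        simp only [m', pow_add]
        ring
    _ ≤ A * (3 ^ m' * S) := by gcongr
    _ = A * 3 ^ m' * S := by ring

end Domination

section Completeness

variable {n : ℕ} {ι : Type*} {al : ι → Vr n} {s : ι → ℝ} {d : ι → ℕ}

/-- A bounded set of `V` lies in a tube over a ball. -/
lemma exists_subset_tube_ball {U : Set (Vc n)} (hU : IsBounded U) :
    ∃ R : ℝ, U ⊆ Tube n (Metric.ball 0 R) := by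
  obtain ⟨R, hR⟩ := hU.exists_norm_le
  exact ⟨R + 1, fun lam hlam =>
    mem_ball_zero_iff.2 (by linarith [norm_reP_le lam, hR lam hlam])⟩

/-- A Cauchy sequence is uniformly Cauchy on tubes without any clearing of poles. -/
lemma uniformCauchy_of_cauchy (hal : ∀ i, al i ≠ 0)
    (hloc : ∀ lam : Vc n, ∃ U ∈ 𝓝 lam, {i | (RHyp n (al i) (s i) ∩ U).Nonempty}.Finite)
    (hfin : ∀ ω : Set (Vr n), IsBounded ω →
      {i | (RHyp n (al i) (s i) ∩ Tube n ω).Nonempty}.Finite)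
    {φ : ℕ → Vc n → ℂ} (hφ : ∀ j, DifferentiableOn ℂ (φ j) (hypUnion n al s)ᶜ)
    (hc : ∀ (ω : Set (Vr n)) (_ : IsOpen ω) (hω₂ : IsBounded ω) (m : ℕ), ∀ ε > (0 : ℝ),
      ∃ N : ℕ, ∀ j ≥ N, ∀ k ≥ N, ∀ lam ∈ Tube n ω \ hypUnion n al s,
        (1 + ‖lam‖) ^ m *
          ‖polyS n al s d (hfin ω hω₂).toFinset lam * (φ j lam - φ k lam)‖ ≤ ε)
    {ω : Set (Vr n)} (hω₁ : IsOpen ω) (hω₂ : IsBounded ω) {ε : ℝ} (hε : 0 < ε) :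
    ∃ N : ℕ, ∀ j ≥ N, ∀ k ≥ N, ∀ lam ∈ Tube n ω \ hypUnion n al s,
      ‖φ j lam - φ k lam‖ ≤ ε := by
  obtain ⟨ω', ho, hb, hsub, hemp⟩ := exists_isOpen_tube_inter_genericSet hfin hω₁ hω₂
  obtain ⟨N, hN⟩ := hc ω' ho hb 0 ε hε
  refine ⟨N, fun j hj k hk lam hlam => ?_⟩
  refine le_of_forall_genericSet_le (G := fun lam => ‖φ j lam - φ k lam‖) hal hfin
    ((isOpen_tube hω₁).sdiff (isClosed_hypUnion hloc))
    (((hφ j).continuousOn.sub (hφ k).continuousOn).norm.mono fun x hx => hx.2) ?_ hlam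
  rintro mu ⟨⟨h1, -⟩, h2⟩
  simpa [hemp, polyS] using hN j hj k hk mu (hsub ⟨h1, h2⟩)

lemma tendsto_of_forall_norm_sub_le {u : ℕ → ℂ}
    (h : ∀ ε > (0 : ℝ), ∃ N, ∀ j ≥ N, ∀ k ≥ N, ‖u j - u k‖ ≤ ε) :
    Tendsto u atTop (𝓝 (limUnder atTop u)) := by
  refine CauchySeq.tendsto_limUnder (Metric.cauchySeq_iff.2 fun ε hε => ?_)
  obtain ⟨N, hN⟩ := h (ε / 2) (half_pos hε)
  exact ⟨N, fun j hj k hk => by rw [dist_eq_norm]; linarith [hN j hj k hk]⟩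

/-- Sequential completeness of `P(V, 𝓗, d)`. -/
lemma exists_limit_memP (hal : ∀ i, al i ≠ 0)
    (hloc : ∀ lam : Vc n, ∃ U ∈ 𝓝 lam, {i | (RHyp n (al i) (s i) ∩ U).Nonempty}.Finite)
    (hfin : ∀ ω : Set (Vr n), IsBounded ω →
      {i | (RHyp n (al i) (s i) ∩ Tube n ω).Nonempty}.Finite)
    {φ : ℕ → Vc n → ℂ} (hφ : ∀ j, MemP n al s d (φ j))
    (hc : ∀ (ω : Set (Vr n)) (_ : IsOpen ω) (hω₂ : IsBounded ω) (m : ℕ), ∀ ε > (0 : ℝ),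
      ∃ N : ℕ, ∀ j ≥ N, ∀ k ≥ N, ∀ lam ∈ Tube n ω \ hypUnion n al s,
        (1 + ‖lam‖) ^ m *
          ‖polyS n al s d (hfin ω hω₂).toFinset lam * (φ j lam - φ k lam)‖ ≤ ε) :
    ∃ ψ : Vc n → ℂ, MemP n al s d ψ ∧
      ∀ (ω : Set (Vr n)) (_ : IsOpen ω) (hω₂ : IsBounded ω) (m : ℕ), ∀ ε > (0 : ℝ),
        ∃ N : ℕ, ∀ j ≥ N, ∀ lam ∈ Tube n ω \ hypUnion n al s,
          (1 + ‖lam‖) ^ m *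
            ‖polyS n al s d (hfin ω hω₂).toFinset lam * (φ j lam - ψ lam)‖ ≤ ε := by
  have hclosed := isClosed_hypUnion hloc
  have hunif : ∀ (R : ℝ) (ε : ℝ), 0 < ε → ∃ N : ℕ, ∀ j ≥ N, ∀ k ≥ N,
      ∀ lam ∈ Tube n (Metric.ball 0 R) \ hypUnion n al s, ‖φ j lam - φ k lam‖ ≤ ε :=
    fun R ε hε => uniformCauchy_of_cauchy hal hloc hfin (fun j => (hφ j).1.1) hc
      Metric.isOpen_ball Metric.isBounded_ball hε
  set ψ : Vc n → ℂ := fun lam => limUnder atTop fun j => φ j lam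
  have hmem : ∀ lam : Vc n, lam ∈ Tube n (Metric.ball 0 (‖reP n lam‖ + 1)) := fun lam =>
    mem_ball_zero_iff.2 (lt_add_one _)
  have hψ : ∀ lam ∉ hypUnion n al s, Tendsto (fun j => φ j lam) atTop (𝓝 (ψ lam)) := by
    refine fun lam hlam => tendsto_of_forall_norm_sub_le fun ε hε => ?_
    obtain ⟨N, hN⟩ := hunif _ ε hε
    exact ⟨N, fun j hj k hk => hN j hj k hk lam ⟨hmem lam, hlam⟩⟩
  have hconv : ∀ (ω : Set (Vr n)) (_ : IsOpen ω) (hω₂ : IsBounded ω) (m : ℕ), ∀ ε > (0 : ℝ),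
      ∃ N : ℕ, ∀ j ≥ N, ∀ lam ∈ Tube n ω \ hypUnion n al s,
        (1 + ‖lam‖) ^ m *
          ‖polyS n al s d (hfin ω hω₂).toFinset lam * (φ j lam - ψ lam)‖ ≤ ε := by
    intro ω hω₁ hω₂ m ε hε
    obtain ⟨N, hN⟩ := hc ω hω₁ hω₂ m ε hε
    refine ⟨N, fun j hj lam hlam => ?_⟩
    have ht : Tendsto (fun k => (1 + ‖lam‖) ^ m *
        ‖polyS n al s d (hfin ω hω₂).toFinset lam * (φ j lam - φ k lam)‖) atTop
        (𝓝 ((1 + ‖lam‖) ^ m *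
          ‖polyS n al s d (hfin ω hω₂).toFinset lam * (φ j lam - ψ lam)‖)) :=
      (((hψ lam hlam.2).const_sub _).const_mul _).norm.const_mul _
    refine le_of_tendsto ht ?_
    filter_upwards [eventually_ge_atTop N] with k hk using hN j hj k hk lam hlam
  refine ⟨ψ, ⟨⟨?_, ?_⟩, ?_⟩, hconv⟩
  · intro lam hlam
    have hopen : IsOpen (Tube n (Metric.ball 0 (‖reP n lam‖ + 1)) \ hypUnion n al s) :=
      (isOpen_tube Metric.isOpen_ball).sdiff hclosed
    refine ((differentiableOn_of_uniformCauchySeqOn hopen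
      (fun j => (hφ j).1.1.mono fun x hx => hx.2) (hunif _)
      fun x hx => hψ x hx.2).differentiableAt
        (hopen.mem_nhds ⟨hmem lam, hlam⟩)).differentiableWithinAt
  · intro U hU hUb hUfin
    obtain ⟨R, hR⟩ := exists_subset_tube_ball hUb
    obtain ⟨B, hB⟩ := hUb.exists_norm_le
    choose Φ hΦd hΦ using fun j => (hφ j).1.2 U hU hUb hUfin
    set F := hUfin.toFinset
    set A := (∏ i ∈ F, (‖al i‖ + |s i|) ^ d i) * (1 + |B|) ^ (∑ i ∈ F, d i)
    have hA : 0 ≤ A :=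
      mul_nonneg (Finset.prod_nonneg fun i _ => by positivity) (by positivity)
    have hpoly : ∀ lam ∈ U, ‖polyS n al s d F lam‖ ≤ A := fun lam hlam => by
      refine (norm_polyS_le al s d F lam).trans ?_
      refine mul_le_mul_of_nonneg_left ?_ (Finset.prod_nonneg fun i _ => by positivity)
      gcongr
      exact (hB lam hlam).trans (le_abs_self B)
    have hΦc : ∀ ε > 0, ∃ N, ∀ j ≥ N, ∀ k ≥ N, ∀ lam ∈ U, ‖Φ j lam - Φ k lam‖ ≤ ε := by
      intro ε hε
      obtain ⟨N, hN⟩ := hunif R (ε / (A + 1)) (by positivity)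
      refine ⟨N, fun j hj k hk lam hlam => ?_⟩
      refine le_of_forall_genericSet_le (G := fun lam => ‖Φ j lam - Φ k lam‖) hal hfin hU
        ((hΦd j).continuousOn.sub (hΦd k).continuousOn).norm ?_ hlam
      rintro mu ⟨hmu, hmu'⟩
      have hmu'' := genericSet_subset_compl hmu'
      rw [hΦ j mu hmu hmu'', hΦ k mu hmu hmu'', ← mul_sub, norm_mul]
      calc _ ≤ A * (ε / (A + 1)) :=
            mul_le_mul (hpoly mu hmu) (hN j hj k hk mu ⟨hR hmu, hmu''⟩) (norm_nonneg _) hA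
        _ ≤ (A + 1) * (ε / (A + 1)) := by gcongr; linarith
        _ = ε := by field_simp
    have hΦt : ∀ lam ∈ U, Tendsto (fun j => Φ j lam) atTop
        (𝓝 (limUnder atTop fun j => Φ j lam)) := fun lam hlam =>
      tendsto_of_forall_norm_sub_le fun ε hε => by
        obtain ⟨N, hN⟩ := hΦc ε hε
        exact ⟨N, fun j hj k hk => hN j hj k hk lam hlam⟩
    refine ⟨_, differentiableOn_of_uniformCauchySeqOn hU hΦd hΦc hΦt, fun lam hlam hlam' => ?_⟩
    refine tendsto_nhds_unique (hΦt lam hlam) ?_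
    simp only [fun j => hΦ j lam hlam hlam']
    exact (hψ lam hlam').const_mul _
  · intro ω hω₁ hω₂ hωfin m
    obtain ⟨N, hN⟩ := hconv ω hω₁ hω₂ m 1 one_pos
    refine ⟨nuVal n al s d hωfin.toFinset ω m (φ N) + 1, ?_⟩
    rintro _ ⟨⟨lam, hlam⟩, rfl⟩
    have h1 := (hφ N).le_nuVal hω₁ hω₂ hωfin m hlam
    have h2 := hN N le_rfl lam hlam
    refine le_trans ?_ (add_le_add h1 h2)
    rw [← mul_add]
    refine mul_le_mul_of_nonneg_left ((norm_sub_le _ _).trans_eq' ?_) (by positivity)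
    congr 1
    ring

end Completeness

/-- **Statement 3.**  `P(V, 𝓗, d)`, with the seminorms `ν_{ω,m}`, is a Fréchet space:
(i) the topology given by all the seminorms `ν_{ω,m}` (`ω ⊆ V₀` bounded open) coincides
with the one given by the countable subfamily `ν_{B_k,m}` (`B_k` the open ball of radius
`k` about `0` in `V₀`) — expressed by mutual domination of seminorms; (ii) the topology is
Hausdorff: if all seminorms vanish on `φ` then `φ = 0`; (iii) every sequence in
`P(V, 𝓗, d)` that is Cauchy for all the seminorms converges, for all the seminorms, to an
element of `P(V, 𝓗, d)`. -/
theorem pwSpace_frechet (n : ℕ) {ι : Type*} (al : ι → Vr n) (s : ι → ℝ)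
    (d : ι → ℕ) (hal : ∀ i, al i ≠ 0)
    (hinj : Function.Injective fun i => RHyp n (al i) (s i))
    (hloc : ∀ lam : Vc n, ∃ U ∈ 𝓝 lam,
      {i | (RHyp n (al i) (s i) ∩ U).Nonempty}.Finite)
    (hfin : ∀ ω : Set (Vr n), IsBounded ω →
      {i | (RHyp n (al i) (s i) ∩ Tube n ω).Nonempty}.Finite) :
    -- (i) each seminorm of the full family is dominated by one from the countable family …
    (∀ (ω : Set (Vr n)) (hω₁ : IsOpen ω) (hω₂ : IsBounded ω) (m : ℕ),
      ∃ (k : ℕ) (m' : ℕ) (C : ℝ), 0 ≤ C ∧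
        ∀ φ : Vc n → ℂ, MemP n al s d φ →
          nuVal n al s d ((hfin ω hω₂).toFinset) ω m φ ≤
          C * nuVal n al s d
              ((hfin (Metric.ball (0 : Vr n) k) Metric.isBounded_ball).toFinset)
              (Metric.ball (0 : Vr n) k) m' φ) ∧
    -- … and conversely each member of the countable family is dominated by one of the
    -- full family (trivially, being a member of it).
    (∀ (k : ℕ) (m' : ℕ),
      ∃ (ω : Set (Vr n)) (hω₁ : IsOpen ω) (hω₂ : IsBounded ω) (m : ℕ) (C : ℝ), 0 ≤ C ∧
        ∀ φ : Vc n → ℂ, MemP n al s d φ →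
          nuVal n al s d
              ((hfin (Metric.ball (0 : Vr n) k) Metric.isBounded_ball).toFinset)
              (Metric.ball (0 : Vr n) k) m' φ ≤
          C * nuVal n al s d ((hfin ω hω₂).toFinset) ω m φ) ∧
    -- (ii) Hausdorff
    (∀ φ : Vc n → ℂ, MemP n al s d φ →
      (∀ (ω : Set (Vr n)) (hω₁ : IsOpen ω) (hω₂ : IsBounded ω) (m : ℕ),
        nuVal n al s d ((hfin ω hω₂).toFinset) ω m φ = 0) →
      ∀ lam : Vc n, lam ∉ ⋃ i, RHyp n (al i) (s i) → φ lam = 0) ∧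
    -- (iii) sequential completeness
    (∀ φseq : ℕ → Vc n → ℂ, (∀ j, MemP n al s d (φseq j)) →
      (∀ (ω : Set (Vr n)) (hω₁ : IsOpen ω) (hω₂ : IsBounded ω) (m : ℕ), ∀ ε > (0:ℝ),
        ∃ N : ℕ, ∀ j ≥ N, ∀ k ≥ N,
          ∀ lam ∈ Tube n ω \ ⋃ i, RHyp n (al i) (s i),
            (1 + ‖lam‖) ^ m *
              ‖polyS n al s d ((hfin ω hω₂).toFinset) lam *
                (φseq j lam - φseq k lam)‖ ≤ ε) →
      ∃ ψ : Vc n → ℂ, MemP n al s d ψ ∧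
        ∀ (ω : Set (Vr n)) (hω₁ : IsOpen ω) (hω₂ : IsBounded ω) (m : ℕ), ∀ ε > (0:ℝ),
          ∃ N : ℕ, ∀ j ≥ N,
            ∀ lam ∈ Tube n ω \ ⋃ i, RHyp n (al i) (s i),
              (1 + ‖lam‖) ^ m *
                ‖polyS n al s d ((hfin ω hω₂).toFinset) lam *
                  (φseq j lam - ψ lam)‖ ≤ ε) := by
  refine ⟨fun ω _ hω₂ m => exists_nuVal_le_mul_nuVal_ball hal hloc hfin hω₂ _ m,
    fun k m' => ⟨Metric.ball 0 k, Metric.isOpen_ball, Metric.isBounded_ball, m', 1, zero_le_one,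
      fun φ _ => (one_mul _).ge⟩, fun φ hφ h0 lam hlam => ?_,
    fun φseq hφ hc => exists_limit_memP hal hloc hfin hφ hc⟩
  have h1 := hφ.le_nuVal Metric.isOpen_ball Metric.isBounded_ball
    (hfin (Metric.ball 0 (‖reP n lam‖ + 1)) Metric.isBounded_ball) 0
    ⟨mem_ball_zero_iff.2 (lt_add_one _), hlam⟩
  rw [h0 _ Metric.isOpen_ball Metric.isBounded_ball 0, pow_zero, one_mul, norm_le_zero_iff] at h1
  exact (mul_eq_zero.1 h1).resolve_left (polyS_ne_zero hlam)

end
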